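/- Let X be a measurable space, let H be a finite-dimensional complex inner product space, and let ν be a nonatomic positive operator-valued measure on X with values in B(H) which is moreover a quantum probability measure, i.e. ν(X) = I_H. Then the range R_ν = {ν(E) : E measurable} is a closed convex subset of B(H) contained in the set of quantum effects {A ∈ B(H) : 0 ≤ A ≤ I_H} (i.e. A and I_H − A are both positive operators). -/

import Mathlib

open MeasureTheory
open scoped ComplexInnerProductSpace ComplexOrder

theorem exists_pairwise_disjoint_measure_ne_zero {X : Type*} [MeasurableSpace X] {μ : Measure X}
    (hμ : ∀ E, MeasurableSet E → μ E ≠ 0 → ∃ F ⊆ E, MeasurableSet F ∧ μ F ≠ 0 ∧ μ (E \ F) ≠ 0)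
    (m : ℕ) {A : Set X} (hA : MeasurableSet A) (hA0 : μ A ≠ 0) :
    ∃ F : Fin m → Set X, (∀ i, MeasurableSet (F i)) ∧ (∀ i, F i ⊆ A) ∧ (∀ i, μ (F i) ≠ 0) ∧
      ∀ i j, i ≠ j → Disjoint (F i) (F j) := by
  induction m generalizing A with
  | zero => exact ⟨fun _ => A, fun _ => hA, fun _ => subset_rfl, fun _ => hA0, fun i => i.elim0⟩
  | succ m ih =>
    obtain ⟨B, hBA, hB, hB0, hAB⟩ := hμ A hA hA0
    obtain ⟨F, hFm, hFA, hF0, hFd⟩ := ih (hA.diff hB) hAB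
    have hd : ∀ i, Disjoint B (F i) := fun i =>
      Set.disjoint_left.2 fun x hx hx' => (hFA i hx').2 hx
    refine ⟨Fin.cons B F, ?_, ?_, ?_, ?_⟩
    · exact Fin.cases hB hFm
    · exact Fin.cases hBA fun i => (hFA i).trans Set.sdiff_subset
    · exact Fin.cases hB0 hF0
    · intro i j
      refine Fin.cases ?_ (fun i => ?_) i <;> refine Fin.cases ?_ (fun j => ?_) j
      · simp
      · intro _; simpa using hd j
      · intro _; simpa using (hd i).symm
      · intro hij; simpa using hFd i j (by simpa using hij)

theorem exists_bounded_forall_integral_mul_eq_zero {X ι : Type*} [MeasurableSpace X] [Fintype ι]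
    {μ : Measure X}
    (hμ : ∀ E, MeasurableSet E → μ E ≠ 0 → ∃ F ⊆ E, MeasurableSet F ∧ μ F ≠ 0 ∧ μ (E \ F) ≠ 0)
    {f : ι → X → ℝ} (hf : ∀ i, Integrable (f i) μ) {A : Set X} (hA : MeasurableSet A)
    (hA0 : μ A ≠ 0) :
    ∃ k : X → ℝ, Measurable k ∧ (∀ x, |k x| ≤ 1) ∧ (∀ x, x ∉ A → k x = 0) ∧ ¬ k =ᵐ[μ] 0 ∧
      ∀ i, ∫ x, k x * f i x ∂μ = 0 := by
  obtain ⟨F, hFm, hFA, hF0, hFd⟩ :=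
    exists_pairwise_disjoint_measure_ne_zero hμ (Fintype.card ι + 1) hA hA0
  let L : (Fin (Fintype.card ι + 1) → ℝ) →ₗ[ℝ] (ι → ℝ) :=
    Fintype.linearCombination ℝ fun j i => ∫ x in F j, f i x ∂μ
  have hL : L.ker ≠ ⊥ := LinearMap.ker_ne_bot_of_finrank_lt (by simp)
  obtain ⟨a, haL, ha⟩ := (Submodule.ne_bot_iff _).1 hL
  obtain ⟨j, hj⟩ := Function.ne_iff.1 ha
  set c : ℝ := ∑ j, |a j| with hc
  have hc0 : 0 < c := Finset.sum_pos' (fun _ _ => abs_nonneg _) ⟨j, by simp, abs_pos.2 hj⟩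
  refine ⟨fun x => c⁻¹ * ∑ j, a j * (F j).indicator 1 x, ?_, ?_, ?_, ?_, ?_⟩
  · refine Measurable.const_mul (Finset.measurable_sum _ fun j _ => ?_) _
    exact (measurable_one.indicator (hFm j)).const_mul _
  · intro x
    rw [abs_mul, abs_of_pos (inv_pos.2 hc0), inv_mul_le_iff₀ hc0, mul_one]
    refine (Finset.abs_sum_le_sum_abs _ _).trans (Finset.sum_le_sum fun j _ => ?_)
    rw [abs_mul]
    refine mul_le_of_le_one_right (abs_nonneg _) ?_
    by_cases hx : x ∈ F j <;> simp [hx]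
  · intro x hx
    have : ∀ j, x ∉ F j := fun j h => hx (hFA j h)
    simp [this]
  · intro h
    refine hF0 j (measure_mono_null (fun x hx => ?_) (ae_iff.1 h))
    have h1 : ∑ i, a i * (F i).indicator (1 : X → ℝ) x = a j := by
      rw [Finset.sum_eq_single j]
      · simp [hx]
      · intro i _ hij
        have : x ∉ F i := fun h => Set.disjoint_left.1 (hFd i j hij) h hx
        simp [this]
      · simp
    simpa [h1, hc0.ne'] using hj
  · intro i
    have h1 : ∀ x, (c⁻¹ * ∑ j, a j * (F j).indicator (1 : X → ℝ) x) * f i x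
        = c⁻¹ * ∑ j, a j * (F j).indicator (f i) x := by
      intro x
      rw [mul_assoc, Finset.sum_mul]
      congr 1
      refine Finset.sum_congr rfl fun j _ => ?_
      by_cases hx : x ∈ F j <;> simp [hx]
    simp_rw [h1]
    rw [integral_const_mul, integral_finsetSum _
      fun j _ => ((hf i).indicator (hFm j)).const_mul _]
    have h2 := congrFun (LinearMap.mem_ker.1 haL) i
    simp only [L, Fintype.linearCombination_apply, Finset.sum_apply, Pi.smul_apply, smul_eq_mul,
      Pi.zero_apply] at h2
    simp_rw [integral_const_mul, integral_indicator (hFm _)]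
    rw [h2, mul_zero]

/-- The functionals on `L²` represented by functions with values in `[0, 1]`. -/
def unitIntervalFunctionals {X : Type*} [MeasurableSpace X] (μ : Measure X) [IsFiniteMeasure μ] :
    Set (WeakDual ℝ (Lp ℝ 2 μ)) :=
  {φ | ∀ (E : Set X) (hE : MeasurableSet E),
    0 ≤ φ (indicatorConstLp 2 hE (measure_ne_top μ E) (1 : ℝ)) ∧
      φ (indicatorConstLp 2 hE (measure_ne_top μ E) (1 : ℝ)) ≤ μ.real E}

theorem mem_unitIntervalFunctionals_iff {X : Type*} [MeasurableSpace X] {μ : Measure X}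
    [IsFiniteMeasure μ] (φ : WeakDual ℝ (Lp ℝ 2 μ)) (h : Lp ℝ 2 μ)
    (hφ : ∀ g, φ g = inner ℝ g h) :
    φ ∈ unitIntervalFunctionals μ ↔ ∀ᵐ x ∂μ, 0 ≤ h x ∧ h x ≤ 1 := by
  have hi : Integrable h μ := (Lp.memLp h).integrable one_le_two
  simp only [unitIntervalFunctionals, Set.mem_ofPred_eq, hφ, L2.inner_indicatorConstLp_one]
  constructor
  · intro H
    have h0 : 0 ≤ᵐ[μ] h := ae_nonneg_of_forall_setIntegral_nonneg hi fun s hs _ => (H s hs).1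
    have h1 : h ≤ᵐ[μ] fun _ => (1 : ℝ) :=
      ae_le_of_forall_setIntegral_le hi (integrable_const _) fun s hs _ => by
        simpa using (H s hs).2
    filter_upwards [h0, h1] with x h0 h1 using ⟨h0, h1⟩
  · intro H E hE
    have H' := ae_restrict_of_ae (s := E) H
    constructor
    · exact integral_nonneg_of_ae (H'.mono fun x hx => hx.1)
    · calc ∫ x in E, h x ∂μ ≤ ∫ x in E, (1 : ℝ) ∂μ :=
            integral_mono_ae hi.restrict (integrable_const _) (H'.mono fun x hx => hx.2)
        _ = μ.real E := by simp

theorem exists_forall_apply_eq_inner {X : Type*} [MeasurableSpace X] {μ : Measure X}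
    (φ : WeakDual ℝ (Lp ℝ 2 μ)) :
    ∃ h : Lp ℝ 2 μ, ∀ g, φ g = inner ℝ g h :=
  ⟨(InnerProductSpace.toDual ℝ (Lp ℝ 2 μ)).symm (WeakDual.toStrongDual φ), fun g => by
    rw [real_inner_comm, InnerProductSpace.toDual_symm_apply]; rfl⟩

theorem isCompact_unitIntervalFunctionals {X : Type*} [MeasurableSpace X] {μ : Measure X}
    [IsFiniteMeasure μ] : IsCompact (unitIntervalFunctionals μ) := by
  refine WeakDual.isCompact_of_bounded_of_closed ?_ ?_
  · rw [← WeakDual.isBounded_toWeakDual_preimage_iff_isBounded, isBounded_iff_forall_norm_le]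
    refine ⟨(measureUnivNNReal μ : ℝ) ^ (2 : ENNReal).toReal⁻¹ * 1, fun φ hφ => ?_⟩
    obtain ⟨h, hh⟩ := exists_forall_apply_eq_inner (StrongDual.toWeakDual φ)
    have h01 := (mem_unitIntervalFunctionals_iff _ h hh).1 hφ
    have hb : ‖h‖ ≤ (measureUnivNNReal μ : ℝ) ^ (2 : ENNReal).toReal⁻¹ * 1 :=
      Lp.norm_le_of_ae_bound zero_le_one (h01.mono fun x hx => by
        rw [Real.norm_eq_abs, abs_of_nonneg hx.1]; exact hx.2)
    refine (φ.opNorm_le_bound (norm_nonneg h) fun g => ?_).trans hb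
    have hg : φ g = inner ℝ g h := hh g
    rw [hg, mul_comm]
    exact norm_inner_le_norm g h
  · simp only [unitIntervalFunctionals, Set.ofPred_forall]
    refine isClosed_iInter fun E => isClosed_iInter fun hE => ?_
    exact (isClosed_le continuous_const (WeakDual.eval_continuous _)).inter
      (isClosed_le (WeakDual.eval_continuous _) continuous_const)

theorem convex_unitIntervalFunctionals {X : Type*} [MeasurableSpace X] {μ : Measure X}
    [IsFiniteMeasure μ] : Convex ℝ (unitIntervalFunctionals μ) := by
  intro φ hφ ψ hψ a b ha hb hab E hE
  obtain ⟨h1, h2⟩ := hφ E hE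
  obtain ⟨h3, h4⟩ := hψ E hE
  set v := indicatorConstLp 2 hE (measure_ne_top μ E) (1 : ℝ)
  change 0 ≤ a * φ v + b * ψ v ∧ a * φ v + b * ψ v ≤ μ.real E
  obtain rfl : b = 1 - a := by linarith
  constructor
  · positivity
  · nlinarith

theorem exists_setIntegral_eq_of_mem_unitIntervalFunctionals {X ι : Type*}
    [MeasurableSpace X] [Fintype ι] {μ : Measure X} [IsFiniteMeasure μ]
    (hμ : ∀ E, MeasurableSet E → μ E ≠ 0 → ∃ F ⊆ E, MeasurableSet F ∧ μ F ≠ 0 ∧ μ (E \ F) ≠ 0)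
    (f : ι → Lp ℝ 2 μ) {ψ : WeakDual ℝ (Lp ℝ 2 μ)} (hψ : ψ ∈ unitIntervalFunctionals μ) :
    ∃ E, MeasurableSet E ∧ ∀ i, ∫ x in E, f i x ∂μ = ψ (f i) := by
  have hfi : ∀ i, Integrable (f i) μ := fun i => (Lp.memLp (f i)).integrable one_le_two
  let K := unitIntervalFunctionals μ ∩ ⋂ i, {φ : WeakDual ℝ (Lp ℝ 2 μ) | φ (f i) = ψ (f i)}
  have hK : IsCompact K := isCompact_unitIntervalFunctionals.inter_right
    (isClosed_iInter fun i => isClosed_eq (WeakDual.eval_continuous _) continuous_const)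
  have : LocallyConvexSpace ℝ (WeakDual ℝ (Lp ℝ 2 μ)) :=
    (WeakDual.withSeminorms (𝕜 := ℝ) (E := Lp ℝ 2 μ)).toLocallyConvexSpace
  obtain ⟨φ, hφK, hφ⟩ := hK.extremePoints_nonempty ⟨ψ, hψ, by simp⟩
  obtain ⟨h, hh⟩ := exists_forall_apply_eq_inner φ
  have h01 := (mem_unitIntervalFunctionals_iff φ h hh).1 hφK.1
  have hφf : ∀ i, φ (f i) = ψ (f i) := fun i => Set.mem_iInter.1 hφK.2 i
  have hm : Measurable h := (Lp.stronglyMeasurable h).measurable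
  have hnull : ∀ n : ℕ, μ {x | 1 / ((n : ℝ) + 1) ≤ h x ∧ h x ≤ 1 - 1 / ((n : ℝ) + 1)} = 0 := by
    intro n
    by_contra hn
    set ε : ℝ := 1 / ((n : ℝ) + 1) with hε
    have hε0 : 0 < ε := by positivity
    obtain ⟨k, hkm, hk1, hkA, hk0, hkf⟩ := exists_bounded_forall_integral_mul_eq_zero hμ hfi
      ((measurableSet_le measurable_const hm).inter (measurableSet_le hm measurable_const)) hn
    have hkL : MemLp k 2 μ := MemLp.of_bound hkm.aestronglyMeasurable 1 (ae_of_all _ hk1)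
    have hkeq := hkL.coeFn_toLp
    let κ : Lp ℝ 2 μ := hkL.toLp k
    let θ : WeakDual ℝ (Lp ℝ 2 μ) :=
      StrongDual.toWeakDual (InnerProductSpace.toDual ℝ (Lp ℝ 2 μ) κ)
    have hθ : ∀ g, θ g = inner ℝ g κ := fun g => by
      rw [real_inner_comm]; rfl
    have hθf : ∀ i, θ (f i) = 0 := by
      intro i
      rw [hθ, L2.inner_def, ← hkf i]
      refine integral_congr_ae ?_
      filter_upwards [hkeq] with x hx
      simp [κ, hx]
    have key : ∀ s : ℝ, |s| = ε → φ + s • θ ∈ K := by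
      intro s hs
      refine ⟨?_, Set.mem_iInter.2 fun i => ?_⟩
      · refine (mem_unitIntervalFunctionals_iff _ (h + s • κ) fun g => ?_).2 ?_
        · change φ g + s * θ g = _
          rw [hh, hθ, inner_add_right, inner_smul_right]
        · filter_upwards [h01, hkeq, Lp.coeFn_add h (s • κ), Lp.coeFn_smul s κ] with x hx hk ha hs'
          rw [ha, Pi.add_apply, hs', Pi.smul_apply, hk, smul_eq_mul]
          by_cases hxA : x ∈ {x | ε ≤ h x} ∩ {x | h x ≤ 1 - ε}
          · have : |s * k x| ≤ ε := by
              rw [abs_mul, hs]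
              exact mul_le_of_le_one_right hε0.le (hk1 x)
            have h3 := abs_le.1 this
            have h4 : ε ≤ h x := hxA.1
            have h5 : h x ≤ 1 - ε := hxA.2
            constructor <;> linarith
          · simpa [hkA x hxA] using hx
      · change φ (f i) + s * θ (f i) = _
        rw [hθf, hφf, mul_zero, add_zero]
    have hext := hφ (key ε (abs_of_pos hε0)) (key (-ε) (by rw [abs_neg, abs_of_pos hε0]))
      ⟨1 / 2, 1 / 2, by norm_num, by norm_num, by norm_num, by module⟩
    have hθ0 : θ = 0 := by
      have : ε • θ = 0 := by simpa using hext
      exact (smul_eq_zero.1 this).resolve_left hε0.ne'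
    have hκ0 : κ = 0 := by
      have h6 := hθ κ
      rw [hθ0] at h6
      exact inner_self_eq_zero.1 h6.symm
    refine hk0 (hkeq.symm.trans ?_)
    have : hkL.toLp k = 0 := hκ0
    rw [this]
    exact Lp.coeFn_zero _ _ _
  refine ⟨{x | h x = 1}, hm (measurableSet_singleton 1), fun i => ?_⟩
  have hE : MeasurableSet {x | h x = 1} := hm (measurableSet_singleton 1)
  have hae : ∀ᵐ x ∂μ, h x = 0 ∨ h x = 1 := by
    have h7 : ∀ᵐ x ∂μ, ∀ n : ℕ,
        ¬ (1 / ((n : ℝ) + 1) ≤ h x ∧ h x ≤ 1 - 1 / ((n : ℝ) + 1)) :=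
      ae_all_iff.2 fun n => by rw [ae_iff]; simpa only [not_not] using hnull n
    filter_upwards [h7, h01] with x hx hx01
    by_contra! hne
    have hpos : 0 < min (h x) (1 - h x) :=
      lt_min (lt_of_le_of_ne hx01.1 hne.1.symm) (sub_pos.2 (lt_of_le_of_ne hx01.2 hne.2))
    obtain ⟨n, hn⟩ := exists_nat_one_div_lt hpos
    have := lt_min_iff.1 hn
    exact hx n ⟨this.1.le, by linarith [this.2]⟩
  rw [← hφf, hh, L2.inner_def, ← integral_indicator hE]
  refine integral_congr_ae ?_
  filter_upwards [hae] with x hx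
  rcases hx with hx | hx <;> simp [hx, Set.indicator]

/-- **Lyapunov's convexity theorem** for finitely many finite measures. -/
theorem isClosed_and_convex_range_of_le {X ι : Type*} [MeasurableSpace X] [Fintype ι]
    {μ : Measure X} [IsFiniteMeasure μ]
    (hμ : ∀ E, MeasurableSet E → μ E ≠ 0 → ∃ F ⊆ E, MeasurableSet F ∧ μ F ≠ 0 ∧ μ (E \ F) ≠ 0)
    (ρ : ι → Measure X) (hρ : ∀ i, ρ i ≤ μ) :
    IsClosed {v : ι → ℝ | ∃ E, MeasurableSet E ∧ (fun i => (ρ i).real E) = v} ∧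
      Convex ℝ {v : ι → ℝ | ∃ E, MeasurableSet E ∧ (fun i => (ρ i).real E) = v} := by
  have : ∀ i, IsFiniteMeasure (ρ i) := fun i => isFiniteMeasure_of_le μ (hρ i)
  have hL : ∀ i, MemLp (fun x => ((ρ i).rnDeriv μ x).toReal) 2 μ := fun i => by
    refine MemLp.of_bound
      (Measure.measurable_rnDeriv _ _).ennreal_toReal.aestronglyMeasurable 1 ?_
    filter_upwards [Measure.rnDeriv_le_one_of_le (hρ i)] with x hx
    simpa using ENNReal.toReal_mono ENNReal.one_ne_top hx
  let f : ι → Lp ℝ 2 μ := fun i => (hL i).toLp _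
  have hf : ∀ i E, ∫ x in E, f i x ∂μ = (ρ i).real E := fun i E => by
    rw [← Measure.setIntegral_toReal_rnDeriv (Measure.absolutelyContinuous_of_le (hρ i)) E]
    exact integral_congr_ae (ae_restrict_of_ae (hL i).coeFn_toLp)
  let T : WeakDual ℝ (Lp ℝ 2 μ) →ₗ[ℝ] (ι → ℝ) :=
    { toFun := fun φ i => φ (f i), map_add' := fun _ _ => rfl, map_smul' := fun _ _ => rfl }
  have hT : Continuous T := continuous_pi fun i => WeakDual.eval_continuous (f i)
  have heq : {v : ι → ℝ | ∃ E, MeasurableSet E ∧ (fun i => (ρ i).real E) = v} =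
      T '' unitIntervalFunctionals μ := by
    ext v
    constructor
    · rintro ⟨E, hE, rfl⟩
      refine ⟨StrongDual.toWeakDual (InnerProductSpace.toDual ℝ (Lp ℝ 2 μ)
        (indicatorConstLp 2 hE (measure_ne_top μ E) 1)), ?_, ?_⟩
      · refine (mem_unitIntervalFunctionals_iff _
          (indicatorConstLp 2 hE (measure_ne_top μ E) 1) fun g => ?_).2 ?_
        · rw [real_inner_comm]; rfl
        · filter_upwards [indicatorConstLp_coeFn (p := 2) (hs := hE)
            (hμs := measure_ne_top μ E) (c := (1 : ℝ))] with x hx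
          rw [hx]
          by_cases hxE : x ∈ E <;> simp [hxE]
      · funext i
        rw [← hf, ← L2.inner_indicatorConstLp_one hE (measure_ne_top μ E)]
        rfl
    · rintro ⟨φ, hφ, rfl⟩
      obtain ⟨E, hE, h⟩ := exists_setIntegral_eq_of_mem_unitIntervalFunctionals hμ f hφ
      exact ⟨E, hE, funext fun i => by rw [← hf, h i]; rfl⟩
  rw [heq]
  exact ⟨(isCompact_unitIntervalFunctionals.image hT).isClosed,
    convex_unitIntervalFunctionals.linear_image T⟩

theorem eq_of_inner_map_self_eq_on_polarization {ι H : Type*} [Fintype ι] [NormedAddCommGroup H]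
    [InnerProductSpace ℂ H] (e : OrthonormalBasis ι ℂ H) {S T : H →L[ℂ] H}
    (h : ∀ p : ι × ι × Fin 4,
      ⟪S (e p.1 + ![1, -1, Complex.I, -Complex.I] p.2.2 • e p.2.1),
        e p.1 + ![1, -1, Complex.I, -Complex.I] p.2.2 • e p.2.1⟫ =
      ⟪T (e p.1 + ![1, -1, Complex.I, -Complex.I] p.2.2 • e p.2.1),
        e p.1 + ![1, -1, Complex.I, -Complex.I] p.2.2 • e p.2.1⟫) :
    S = T := by
  have hin : ∀ j l, ⟪S (e l), e j⟫ = ⟪T (e l), e j⟫ := by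
    intro j l
    have h0 := h (j, l, 0)
    have h1 := h (j, l, 1)
    have h2 := h (j, l, 2)
    have h3 := h (j, l, 3)
    simp only [Matrix.cons_val, one_smul, neg_smul, ← sub_eq_add_neg] at h0 h1 h2 h3
    have hS := inner_map_polarization (S : H →ₗ[ℂ] H) (e j) (e l)
    have hT := inner_map_polarization (T : H →ₗ[ℂ] H) (e j) (e l)
    simp only [ContinuousLinearMap.coe_coe] at hS hT
    rw [hS, hT, h0, h1, h2, h3]
  ext1 x
  have hlin : (S : H →ₗ[ℂ] H) = T := by
    refine e.toBasis.ext fun l => ?_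
    refine InnerProductSpace.ext_inner_right_basis e.toBasis fun j => ?_
    simpa using hin j l
  exact LinearMap.congr_fun hlin x

/-- **Quantum Lyapunov theorem (finite dimensions).** The range of a nonatomic quantum
probability measure (a positive operator-valued measure with `ν X = I`) on the bounded
operators of a finite-dimensional complex Hilbert space is a closed convex set contained
in the set of quantum effects `{A : 0 ≤ A ≤ I}`. -/
theorem quantum_probability_measure_range_closed_convex_effects
    {X : Type*} [MeasurableSpace X]
    {H : Type*} [NormedAddCommGroup H] [InnerProductSpace ℂ H]
    [FiniteDimensional ℂ H]
    (ν : VectorMeasure X (H →L[ℂ] H))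
    (hpos : ∀ E : Set X, MeasurableSet E → ∀ x : H, 0 ≤ ⟪(ν E) x, x⟫)
    (hprob : ν Set.univ = 1)
    (hnonatomic : ∀ E : Set X, MeasurableSet E → ν E ≠ 0 →
      ∃ F ⊆ E, MeasurableSet F ∧ ν F ≠ 0 ∧ ν F ≠ ν E) :
    IsClosed {T : H →L[ℂ] H | ∃ E : Set X, MeasurableSet E ∧ ν E = T} ∧
    Convex ℝ {T : H →L[ℂ] H | ∃ E : Set X, MeasurableSet E ∧ ν E = T} ∧
    {T : H →L[ℂ] H | ∃ E : Set X, MeasurableSet E ∧ ν E = T} ⊆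
      {A : H →L[ℂ] H | (∀ x : H, 0 ≤ ⟪A x, x⟫) ∧ (∀ x : H, 0 ≤ ⟪(1 - A) x, x⟫)} := by
  have hsub : ∀ E F, MeasurableSet E → MeasurableSet F → F ⊆ E → ν F + ν (E \ F) = ν E :=
    fun E F hE hF h => by
      rw [← VectorMeasure.of_union Set.disjoint_sdiff_right hF (hE.diff hF),
        Set.union_sdiff_cancel h]
  let e := stdOrthonormalBasis ℂ H
  let κ := Fin (Module.finrank ℂ H) × Fin (Module.finrank ℂ H) × Fin 4
  let w : κ → H := fun p => e p.1 + ![1, -1, Complex.I, -Complex.I] p.2.2 • e p.2.1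
  let q : H → (H →L[ℂ] H) →L[ℝ] ℝ := fun x =>
    { toFun := fun T => (⟪T x, x⟫).re
      map_add' := fun S T => by simp
      map_smul' := fun c T => by simp
      cont := by fun_prop }
  let σ : κ → SignedMeasure X := fun p =>
    ν.mapRange ((q (w p) : (H →L[ℂ] H) →ₗ[ℝ] ℝ) : (H →L[ℂ] H) →+ ℝ) (q (w p)).continuous
  have hσ : ∀ p E, σ p E = (⟪ν E (w p), w p⟫).re := fun p E => rfl
  have hσ0 : ∀ p, 0 ≤[Set.univ] σ p := fun p =>
    (VectorMeasure.le_restrict_univ_iff_le _ _).2 fun E hE => (Complex.le_def.1 (hpos E hE _)).1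
  let ρ : κ → Measure X := fun p => (σ p).toMeasureOfZeroLE Set.univ .univ (hσ0 p)
  have hρ : ∀ p E, MeasurableSet E → (ρ p).real E = (⟪ν E (w p), w p⟫).re := fun p E hE => by
    rw [← hσ, measureReal_def, SignedMeasure.toMeasureOfZeroLE_apply _ (hσ0 p) .univ hE]
    simp
  let μ : Measure X := ∑ p, ρ p
  have hle : ∀ p, ρ p ≤ μ := fun p =>
    Finset.single_le_sum (fun _ _ => Measure.zero_le _) (Finset.mem_univ p)
  have him : ∀ E, MeasurableSet E → ∀ x, (⟪ν E x, x⟫).im = 0 := fun E hE x =>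
    (Complex.le_def.1 (hpos E hE x)).2.symm
  have hnull : ∀ E, MeasurableSet E → (μ E = 0 ↔ ν E = 0) := by
    intro E hE
    have h1 : μ E = ∑ p, ρ p E := by simp [μ]
    rw [h1, Finset.sum_eq_zero_iff]
    constructor
    · intro h
      refine eq_of_inner_map_self_eq_on_polarization e fun p => ?_
      change ⟪ν E (w p), w p⟫ = ⟪(0 : H →L[ℂ] H) (w p), w p⟫
      apply Complex.ext
      · rw [← hρ p E hE, measureReal_def, h p (Finset.mem_univ p)]; simp
      · rw [him E hE]; simp
    · intro h p _
      have h2 := hρ p E hE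
      rw [h] at h2
      simpa [measureReal_eq_zero_iff] using h2
  have hμ : ∀ E, MeasurableSet E → μ E ≠ 0 →
      ∃ F ⊆ E, MeasurableSet F ∧ μ F ≠ 0 ∧ μ (E \ F) ≠ 0 := by
    intro E hE hE0
    obtain ⟨F, hFE, hF, hF0, hne⟩ := hnonatomic E hE (mt (hnull E hE).2 hE0)
    refine ⟨F, hFE, hF, mt (hnull F hF).1 hF0, fun h => hne ?_⟩
    rw [← hsub E F hE hF hFE, (hnull _ (hE.diff hF)).1 h, add_zero]
  obtain ⟨hclosed, hconvex⟩ := isClosed_and_convex_range_of_le hμ ρ hle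
  let Φ : (H →L[ℂ] H) →L[ℝ] (κ → ℝ) := ContinuousLinearMap.pi fun p => q (w p)
  have hrange : {T : H →L[ℂ] H | ∃ E : Set X, MeasurableSet E ∧ ν E = T} =
      {T : H →L[ℂ] H | ∀ x, (⟪T x, x⟫).im = 0} ∩
        Φ ⁻¹' {v | ∃ E, MeasurableSet E ∧ (fun p => (ρ p).real E) = v} := by
    ext T
    constructor
    · rintro ⟨E, hE, rfl⟩
      exact ⟨him E hE, E, hE, funext fun p => hρ p E hE⟩
    · rintro ⟨hT, E, hE, h⟩
      refine ⟨E, hE, eq_of_inner_map_self_eq_on_polarization e fun p => Complex.ext ?_ ?_⟩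
      · exact (hρ p E hE).symm.trans (congrFun h p)
      · rw [him E hE, hT]
  refine ⟨?_, ?_, ?_⟩
  · rw [hrange]
    refine IsClosed.inter ?_ (hclosed.preimage Φ.continuous)
    rw [Set.ofPred_forall]
    exact isClosed_iInter fun x => isClosed_eq (by fun_prop) continuous_const
  · rw [hrange]
    refine Convex.inter ?_ (hconvex.linear_preimage (Φ : (H →L[ℂ] H) →ₗ[ℝ] (κ → ℝ)))
    intro S hS T hT a b _ _ _ x
    simp [hS x, hT x]
  · rintro _ ⟨E, hE, rfl⟩
    refine ⟨hpos E hE, fun x => ?_⟩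
    rw [← hprob, ← hsub _ E .univ hE (Set.subset_univ E), add_sub_cancel_left]
    exact hpos _ (MeasurableSet.univ.diff hE) x
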